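/- Under the elliptic projective Lelieuvre relations, the full determinants change sign: at every point p ∈ ℝ², det(f,f_x,f_y,f_{xx}) = −det(ν,ν_x,ν_y,ν_{xx}) and det(f,f_x,f_y,f_{yy}) = −det(ν,ν_x,ν_y,ν_{yy}). -/

import Mathlib

noncomputable section

/-- Euclidean pairing on `ℝ⁴`. -/
def dot4 (a b : Fin 4 → ℝ) : ℝ := ∑ i, a i * b i

/-- Determinant of the 4×4 matrix with rows `a, b, c, d`. -/
def det4 (a b c d : Fin 4 → ℝ) : ℝ := Matrix.det (Matrix.of ![a, b, c, d])

/-- Partial derivative in the first (`x`) variable. -/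
def dx (g : ℝ × ℝ → Fin 4 → ℝ) : ℝ × ℝ → Fin 4 → ℝ := fun p => fderiv ℝ g p (1, 0)

/-- Partial derivative in the second (`y`) variable. -/
def dy (g : ℝ × ℝ → Fin 4 → ℝ) : ℝ × ℝ → Fin 4 → ℝ := fun p => fderiv ℝ g p (0, 1)

theorem dot4_expand (a b : Fin 4 → ℝ) :
    dot4 a b = a 0 * b 0 + a 1 * b 1 + a 2 * b 2 + a 3 * b 3 := by
  simp [dot4, Fin.sum_univ_four]

theorem dot4_comm (a b : Fin 4 → ℝ) : dot4 a b = dot4 b a := by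
  rw [dot4_expand, dot4_expand]
  ring

theorem det4_expand (a b c d : Fin 4 → ℝ) :
    det4 a b c d =
      (a 0 * b 1 - a 1 * b 0) * (c 2 * d 3 - c 3 * d 2)
      - (a 0 * b 2 - a 2 * b 0) * (c 1 * d 3 - c 3 * d 1)
      + (a 0 * b 3 - a 3 * b 0) * (c 1 * d 2 - c 2 * d 1)
      + (a 1 * b 2 - a 2 * b 1) * (c 0 * d 3 - c 3 * d 0)
      - (a 1 * b 3 - a 3 * b 1) * (c 0 * d 2 - c 2 * d 0)
      + (a 2 * b 3 - a 3 * b 2) * (c 0 * d 1 - c 1 * d 0) := by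
  simp [det4, Matrix.det_succ_row_zero, Fin.sum_univ_succ, Fin.succAbove]
  ring

/-- The Hodge star on bivectors of `ℝ⁴` is an involution. -/
theorem det4_of_wedge_eq_star {c : ℝ} {f g n m : Fin 4 → ℝ}
    (h : ∀ w z, dot4 w f * dot4 z g - dot4 z f * dot4 w g = c * det4 w z n m)
    (w z : Fin 4 → ℝ) :
    det4 w z f g = c * (dot4 w n * dot4 z m - dot4 z n * dot4 w m) := by
  have h01 := h (Pi.single 0 1) (Pi.single 1 1)
  have h02 := h (Pi.single 0 1) (Pi.single 2 1)
  have h03 := h (Pi.single 0 1) (Pi.single 3 1)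
  have h12 := h (Pi.single 1 1) (Pi.single 2 1)
  have h13 := h (Pi.single 1 1) (Pi.single 3 1)
  have h23 := h (Pi.single 2 1) (Pi.single 3 1)
  simp [dot4_expand, det4_expand] at h01 h02 h03 h12 h13 h23
  rw [det4_expand]
  simp only [dot4_expand]
  linear_combination (w 0 * z 1 - w 1 * z 0) * h23 - (w 0 * z 2 - w 2 * z 0) * h13
    + (w 0 * z 3 - w 3 * z 0) * h12 + (w 1 * z 2 - w 2 * z 1) * h03
    - (w 1 * z 3 - w 3 * z 1) * h02 + (w 2 * z 3 - w 3 * z 2) * h01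

theorem dot4_eq_zero_of_wedge_eq_star {c : ℝ} {f g n m : Fin 4 → ℝ}
    (h : ∀ w z, dot4 w f * dot4 z g - dot4 z f * dot4 w g = c * det4 w z n m)
    (hf : f ≠ 0) (hfn : dot4 f n = 0) : dot4 g n = 0 := by
  have key := h f n
  have hdet : det4 f n n m = 0 := by
    rw [det4_expand]
    ring
  rw [hdet, dot4_comm n f, hfn, dot4_comm n g, zero_mul, sub_zero, mul_zero] at key
  refine (mul_eq_zero.mp key).resolve_left fun h0 => hf ?_
  exact dotProduct_self_eq_zero.mp h0

theorem det4_swap_pairs (a b c d : Fin 4 → ℝ) : det4 a b c d = det4 c d a b := by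
  rw [det4_expand, det4_expand]
  ring

theorem dot4_fderiv_eq_neg {E : Type*} [NormedAddCommGroup E] [NormedSpace ℝ E]
    {g h : E → Fin 4 → ℝ} (hg : Differentiable ℝ g) (hh : Differentiable ℝ h)
    (h0 : ∀ p, dot4 (g p) (h p) = 0) (p v : E) :
    dot4 (fderiv ℝ g p v) (h p) = -dot4 (g p) (fderiv ℝ h p v) := by
  have hsum : HasFDerivAt (fun q => dot4 (g q) (h q)) (∑ i,
      (g p i • (ContinuousLinearMap.proj i).comp (fderiv ℝ h p)
        + h p i • (ContinuousLinearMap.proj i).comp (fderiv ℝ g p))) p :=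
    HasFDerivAt.fun_sum fun i _ =>
      (hasFDerivAt_pi'.mp (hg p).hasFDerivAt i).mul (hasFDerivAt_pi'.mp (hh p).hasFDerivAt i)
  have hzero : HasFDerivAt (fun q => dot4 (g q) (h q)) (0 : E →L[ℝ] ℝ) p := by
    simpa only [h0] using hasFDerivAt_const (0 : ℝ) p
  have key := congrArg (fun L : E →L[ℝ] ℝ => L v) (hsum.unique hzero)
  simp [Fin.sum_univ_four] at key
  rw [dot4_expand, dot4_expand]
  linear_combination key

theorem stmt10 (f ν : ℝ × ℝ → Fin 4 → ℝ)
    (hsf : ContDiff ℝ (⊤ : ℕ∞) f) (hsν : ContDiff ℝ (⊤ : ℕ∞) ν)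
    (hpair : ∀ p, dot4 (f p) (ν p) = 0)
    (hLx : ∀ p, ∀ w z : Fin 4 → ℝ,
      dot4 w (f p) * dot4 z (dx f p) - dot4 z (f p) * dot4 w (dx f p)
        = - det4 w z (ν p) (dy ν p))
    (hLy : ∀ p, ∀ w z : Fin 4 → ℝ,
      dot4 w (f p) * dot4 z (dy f p) - dot4 z (f p) * dot4 w (dy f p)
        = det4 w z (ν p) (dx ν p))
    (hf0 : ∀ p, f p ≠ 0) (hν0 : ∀ p, ν p ≠ 0) :
    ∀ p : ℝ × ℝ,
      det4 (f p) (dx f p) (dy f p) (dx (dx f) p)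
        = - det4 (ν p) (dx ν p) (dy ν p) (dx (dx ν) p) ∧
      det4 (f p) (dx f p) (dy f p) (dy (dy f) p)
        = - det4 (ν p) (dx ν p) (dy ν p) (dy (dy ν) p) := by
  have hdf := hsf.differentiable (by simp)
  have hdν := hsν.differentiable (by simp)
  have hdiff : ∀ {g : ℝ × ℝ → Fin 4 → ℝ} (v : ℝ × ℝ), ContDiff ℝ (⊤ : ℕ∞) g →
      Differentiable ℝ fun p => fderiv ℝ g p v := fun v hg =>
    ((hg.fderiv_right (m := 1) (by norm_cast)).clm_apply contDiff_const).differentiable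
      one_ne_zero
  have hdxf : Differentiable ℝ (dx f) := hdiff (1, 0) hsf
  have hdyf : Differentiable ℝ (dy f) := hdiff (0, 1) hsf
  have hdxν : Differentiable ℝ (dx ν) := hdiff (1, 0) hsν
  have hdyν : Differentiable ℝ (dy ν) := hdiff (0, 1) hsν
  have hLx' : ∀ p, ∀ w z : Fin 4 → ℝ,
      dot4 w (f p) * dot4 z (dx f p) - dot4 z (f p) * dot4 w (dx f p)
        = (-1) * det4 w z (ν p) (dy ν p) := fun p w z => by rw [hLx, neg_one_mul]
  have hLy' : ∀ p, ∀ w z : Fin 4 → ℝ,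
      dot4 w (f p) * dot4 z (dy f p) - dot4 z (f p) * dot4 w (dy f p)
        = 1 * det4 w z (ν p) (dx ν p) := fun p w z => by rw [hLy, one_mul]
  have hfxν p : dot4 (dx f p) (ν p) = 0 :=
    dot4_eq_zero_of_wedge_eq_star (hLx' p) (hf0 p) (hpair p)
  have hfyν p : dot4 (dy f p) (ν p) = 0 :=
    dot4_eq_zero_of_wedge_eq_star (hLy' p) (hf0 p) (hpair p)
  have hfνx p : dot4 (f p) (dx ν p) = 0 :=
    neg_eq_zero.mp ((dot4_fderiv_eq_neg hdf hdν hpair p (1, 0)).symm.trans (hfxν p))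
  have hfνy p : dot4 (f p) (dy ν p) = 0 :=
    neg_eq_zero.mp ((dot4_fderiv_eq_neg hdf hdν hpair p (0, 1)).symm.trans (hfyν p))
  intro p
  have hfxx : dot4 (dx (dx f) p) (ν p) = -dot4 (dx f p) (dx ν p) :=
    dot4_fderiv_eq_neg hdxf hdν hfxν p (1, 0)
  have hfyy : dot4 (dy (dy f) p) (ν p) = -dot4 (dy f p) (dy ν p) :=
    dot4_fderiv_eq_neg hdyf hdν hfyν p (0, 1)
  have hνxx : dot4 (dx f p) (dx ν p) = -dot4 (f p) (dx (dx ν) p) :=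
    dot4_fderiv_eq_neg hdf hdxν hfνx p (1, 0)
  have hνyy : dot4 (dy f p) (dy ν p) = -dot4 (f p) (dy (dy ν) p) :=
    dot4_fderiv_eq_neg hdf hdyν hfνy p (0, 1)
  have hdetf w : det4 (f p) (dx f p) (dy f p) w = dot4 w (ν p) * dot4 (dy f p) (dy ν p) := by
    rw [det4_swap_pairs, det4_of_wedge_eq_star (hLx' p), hfyν]
    ring
  have hdetν w : det4 (ν p) (dx ν p) (dy ν p) w = -(dot4 (f p) w * dot4 (dy f p) (dy ν p)) := by
    rw [det4_swap_pairs, ← hLy, dot4_comm (dy ν p) (f p), hfνy, dot4_comm w (f p),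
      dot4_comm (dy ν p) (dy f p)]
    ring
  constructor
  · rw [hdetf, hdetν, hfxx, hνxx]
    ring
  · rw [hdetf, hdetν, hfyy, hνyy]
    ring
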